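/- Let T be a non-invertible expansive bounded operator (‖Tx‖ ≥ ‖x‖ for all x) on a Hilbert space with σ_ap(T) ⊆ ∂𝔻, and let T' = T(T*T)^{-1} be its Cauchy dual. Then σ(T) = closure(𝔻) = σ(T') and σ_ap(T) = ∂𝔻 = σ_ap(T'). -/

import Mathlib

open ContinuousLinearMap

/-- The Cauchy dual `T' = T (T*T)⁻¹` of a left-invertible operator. -/
noncomputable def cauchyDual {H : Type*} [NormedAddCommGroup H] [InnerProductSpace ℂ H]
    [CompleteSpace H] (T : H →L[ℂ] H) : H →L[ℂ] H :=
  T * Ring.inverse (adjoint T * T)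

/-- The approximate point spectrum: `z` such that `T - z·I` is not bounded below. -/
def approxPointSpectrum {H : Type*} [NormedAddCommGroup H] [InnerProductSpace ℂ H]
    [CompleteSpace H] (T : H →L[ℂ] H) : Set ℂ :=
  {z | ¬ ∃ c : ℝ, 0 < c ∧ ∀ x : H, c * ‖x‖ ≤ ‖(T - z • (1 : H →L[ℂ] H)) x‖}

lemma IsPreconnected.inter_frontier_nonempty {X : Type*} [TopologicalSpace X] {t s : Set X}
    (ht : IsPreconnected t) (h1 : (t ∩ s).Nonempty) (h2 : (t ∩ sᶜ).Nonempty) :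
    (t ∩ frontier s).Nonempty := by
  by_contra hne
  have hnot : ∀ x ∈ t, x ∉ frontier s := fun x hx hf => hne ⟨x, hx, hf⟩
  have hint : ∀ x ∈ t, x ∈ s → x ∈ interior s := fun x hx hs => by
    by_contra hi
    exact hnot x hx ⟨subset_closure hs, hi⟩
  have hext : ∀ x ∈ t, x ∈ sᶜ → x ∈ interior sᶜ := fun x hx hs => by
    by_contra hi
    exact hnot x hx (frontier_compl s ▸ ⟨subset_closure hs, hi⟩)
  obtain ⟨x, -, hx, hx'⟩ := ht (interior s) (interior sᶜ) isOpen_interior isOpen_interior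
    (fun x hx => (em (x ∈ s)).imp (hint x hx) (hext x hx))
    (h1.imp fun x hx => ⟨hx.1, hint x hx.1 hx.2⟩) (h2.imp fun x hx => ⟨hx.1, hext x hx.1 hx.2⟩)
  exact interior_subset hx' (interior_subset hx)

section ApproxPointSpectrum

variable {H : Type*} [NormedAddCommGroup H] [InnerProductSpace ℂ H] [CompleteSpace H]

lemma frontier_spectrum_subset_approxPointSpectrum (A : H →L[ℂ] H) :
    frontier (spectrum ℂ A) ⊆ approxPointSpectrum A := by
  rintro z hz ⟨c, hc, hbd⟩
  have hzσ : z ∈ spectrum ℂ A := (spectrum.isClosed A).frontier_subset hz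
  have hcl : z ∈ closure (spectrum ℂ A)ᶜ := by
    rw [frontier_eq_closure_inter_closure] at hz
    exact hz.2
  obtain ⟨w, hw, hzw⟩ := Metric.mem_closure_iff.1 hcl (c / 2) (by positivity)
  rw [dist_eq_norm] at hzw
  obtain ⟨u, hu⟩ := spectrum.notMem_iff.1 hw
  have hbound : ‖(↑u⁻¹ : H →L[ℂ] H)‖ ≤ 2 / c := by
    refine ContinuousLinearMap.opNorm_le_bound _ (by positivity) fun x => ?_
    set y := (↑u⁻¹ : H →L[ℂ] H) x with hy
    have hx : (w • y - A y) = x := by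
      have h := congrArg (fun B : H →L[ℂ] H => B x) u.mul_inv
      simpa [hu, ← hy, Algebra.algebraMap_eq_smul_one] using h
    have h1 := hbd y
    have h2 : (A - z • (1 : H →L[ℂ] H)) y = -(x + (z - w) • y) := by
      rw [← hx, sub_smul]
      simp
    rw [h2, norm_neg] at h1
    have h3 := norm_add_le x ((z - w) • y)
    rw [norm_smul] at h3
    have h4 : ‖z - w‖ * ‖y‖ ≤ c / 2 * ‖y‖ := by gcongr
    rw [div_mul_eq_mul_div, le_div_iff₀ hc]
    linarith
  refine hzσ ?_
  rcases subsingleton_or_nontrivial (H →L[ℂ] H) with hs | hs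
  · exact isUnit_of_subsingleton _
  · have hpos : 0 < ‖(↑u⁻¹ : H →L[ℂ] H)‖ := Units.norm_pos _
    have hlt : ‖(algebraMap ℂ (H →L[ℂ] H) z - A) - ↑u‖ < ‖(↑u⁻¹ : H →L[ℂ] H)‖⁻¹ := by
      rw [hu, sub_sub_sub_cancel_right, ← map_sub, norm_algebraMap']
      refine hzw.trans_le ?_
      rw [le_inv_comm₀ (by positivity) hpos, inv_div]
      exact hbound
    exact (u.ofNearby _ hlt).isUnit

lemma notMem_approxPointSpectrum_of_mul_sub_eq_one {A B : H →L[ℂ] H} {z : ℂ}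
    (h : B * (A - z • (1 : H →L[ℂ] H)) = 1) : z ∉ approxPointSpectrum A := by
  refine not_not.2 ⟨(‖B‖ + 1)⁻¹, by positivity, fun x => ?_⟩
  rw [inv_mul_le_iff₀ (by positivity)]
  calc ‖x‖ = ‖B ((A - z • (1 : H →L[ℂ] H)) x)‖ := by
        rw [← mul_apply_eq_comp, h, one_apply_eq_self]
    _ ≤ ‖B‖ * ‖(A - z • (1 : H →L[ℂ] H)) x‖ := B.le_opNorm _
    _ ≤ _ := by gcongr; linarith

lemma spectrum_eq_closedBall_of_approxPointSpectrum_subset_sphere {A : H →L[ℂ] H}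
    (hA : ¬ IsUnit A) (hap : approxPointSpectrum A ⊆ Metric.sphere (0 : ℂ) 1) :
    spectrum ℂ A = Metric.closedBall (0 : ℂ) 1 := by
  have hfr : frontier (spectrum ℂ A) ⊆ Metric.sphere (0 : ℂ) 1 :=
    (frontier_spectrum_subset_approxPointSpectrum A).trans hap
  refine Set.Subset.antisymm (fun z hz => ?_) ?_
  · by_contra hz1
    rw [mem_closedBall_zero_iff, not_le] at hz1
    set ray : Set ℂ := (fun t : ℝ => (t : ℂ) * z) '' Set.Ici 1 with hray
    have hpre : IsPreconnected ray :=
      isPreconnected_Ici.image _ (by fun_prop)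
    obtain ⟨R, hR⟩ := (spectrum.isBounded (𝕜 := ℂ) A).exists_norm_le
    have hout : (ray ∩ (spectrum ℂ A)ᶜ).Nonempty := by
      refine ⟨((|R| + 1 : ℝ) : ℂ) * z, ⟨|R| + 1, by simp, rfl⟩, fun hmem => ?_⟩
      have h1 := hR _ hmem
      rw [norm_mul, Complex.norm_real, Real.norm_of_nonneg (by positivity)] at h1
      nlinarith [le_abs_self R, abs_nonneg R]
    obtain ⟨_, ⟨t, ht, rfl⟩, hw⟩ := hpre.inter_frontier_nonempty
      ⟨z, ⟨1, by simp, by simp⟩, hz⟩ hout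
    have h1 := mem_sphere_zero_iff_norm.1 (hfr hw)
    have ht1 : (1 : ℝ) ≤ t := ht
    rw [norm_mul, Complex.norm_real, Real.norm_of_nonneg (by linarith)] at h1
    nlinarith
  · rw [← closure_ball (0 : ℂ) one_ne_zero]
    refine closure_minimal ?_ (spectrum.isClosed A)
    by_contra hsub
    obtain ⟨w, hw, hwσ⟩ := Set.not_subset.1 hsub
    obtain ⟨v, hv, hvfr⟩ := IsPreconnected.inter_frontier_nonempty
      (convex_ball (0 : ℂ) 1).isPreconnected
      ⟨0, by simp, (spectrum.zero_mem_iff ℂ).2 hA⟩ ⟨w, hw, hwσ⟩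
    exact (mem_ball_zero_iff.1 hv).ne (mem_sphere_zero_iff_norm.1 (hfr hvfr))

lemma approxPointSpectrum_eq_sphere {A : H →L[ℂ] H}
    (hA : ¬ IsUnit A) (hap : approxPointSpectrum A ⊆ Metric.sphere (0 : ℂ) 1) :
    approxPointSpectrum A = Metric.sphere (0 : ℂ) 1 := by
  refine hap.antisymm ?_
  rw [← frontier_closedBall (0 : ℂ) one_ne_zero,
    ← spectrum_eq_closedBall_of_approxPointSpectrum_subset_sphere hA hap]
  exact frontier_spectrum_subset_approxPointSpectrum A

end ApproxPointSpectrum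

section CauchyDual

variable {H : Type*} [NormedAddCommGroup H] [InnerProductSpace ℂ H] [CompleteSpace H]
  {T : H →L[ℂ] H}

lemma isUnit_adjoint_mul_self_of_expansive (hexp : ∀ x : H, ‖x‖ ≤ ‖T x‖) :
    IsUnit (adjoint T * T) := by
  refine ContinuousLinearMap.isUnit_of_forall_le_norm_inner_map _ (c := 1) one_pos fun x => ?_
  rw [mul_apply_eq_comp, ContinuousLinearMap.adjoint_inner_left,
    inner_self_eq_norm_sq_to_K]
  simpa using pow_le_pow_left₀ (norm_nonneg x) (hexp x) 2

lemma adjoint_mul_cauchyDual (hexp : ∀ x : H, ‖x‖ ≤ ‖T x‖) :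
    adjoint T * cauchyDual T = 1 := by
  rw [cauchyDual, ← mul_assoc]
  exact Ring.mul_inverse_cancel _ (isUnit_adjoint_mul_self_of_expansive hexp)

lemma norm_cauchyDual_apply_le (hexp : ∀ x : H, ‖x‖ ≤ ‖T x‖) (x : H) :
    ‖cauchyDual T x‖ ≤ ‖x‖ := by
  set y := Ring.inverse (adjoint T * T) x
  have hx : adjoint T (cauchyDual T x) = x := by
    rw [← mul_apply_eq_comp, adjoint_mul_cauchyDual hexp,
      one_apply_eq_self]
  have hy : cauchyDual T x = T y := rfl
  have h1 : ‖T y‖ ^ 2 ≤ ‖x‖ * ‖y‖ := by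
    have h := norm_inner_le_norm (𝕜 := ℂ) x y
    rw [hy] at hx
    nth_rewrite 1 [← hx] at h
    rw [ContinuousLinearMap.adjoint_inner_left, inner_self_eq_norm_sq_to_K] at h
    simpa using h
  rw [hy]
  have h2 := hexp y
  by_contra! h
  nlinarith [norm_nonneg x, norm_nonneg y]

lemma not_isUnit_cauchyDual (hexp : ∀ x : H, ‖x‖ ≤ ‖T x‖) (hni : ¬ IsUnit T) :
    ¬ IsUnit (cauchyDual T) := by
  rintro ⟨u, hu⟩
  refine hni (isUnit_star.1 ?_)
  have h := adjoint_mul_cauchyDual hexp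
  rw [← hu] at h
  rw [ContinuousLinearMap.star_eq_adjoint, ← Units.inv_eq_of_mul_eq_one_left h]
  exact u⁻¹.isUnit

lemma approxPointSpectrum_cauchyDual_subset_sphere (hexp : ∀ x : H, ‖x‖ ≤ ‖T x‖)
    (hσ : spectrum ℂ T ⊆ Metric.closedBall (0 : ℂ) 1) :
    approxPointSpectrum (cauchyDual T) ⊆ Metric.sphere (0 : ℂ) 1 := by
  intro z hz
  rw [mem_sphere_zero_iff_norm]
  rcases lt_trichotomy ‖z‖ 1 with hlt | heq | hgt
  · exfalso
    have hu : IsUnit (1 - z • adjoint T) := by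
      rcases eq_or_ne z 0 with rfl | hz0
      · simp
      have hnot : (star z)⁻¹ ∉ spectrum ℂ T := fun hmem => by
        have h := mem_closedBall_zero_iff.1 (hσ hmem)
        rw [norm_inv, norm_star] at h
        exact (one_lt_inv₀ (norm_pos_iff.2 hz0)).2 hlt |>.not_ge h
      have h1 := (spectrum.notMem_iff.1 hnot).star
      have h2 : (1 - z • adjoint T) =
          Units.mk0 z hz0 • star (algebraMap ℂ (H →L[ℂ] H) (star z)⁻¹ - T) := by
        rw [Units.smul_mk0, star_sub, smul_sub, ContinuousLinearMap.star_eq_adjoint T,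
          Algebra.algebraMap_eq_smul_one, star_smul, star_one, star_inv₀, star_star, smul_smul,
          mul_inv_cancel₀ hz0, one_smul]
      rw [h2]
      exact h1.smul _
    obtain ⟨u, hu⟩ := hu
    refine notMem_approxPointSpectrum_of_mul_sub_eq_one (B := (↑u⁻¹ : H →L[ℂ] H) * adjoint T) ?_ hz
    rw [mul_assoc, mul_sub, adjoint_mul_cauchyDual hexp, mul_smul_comm, mul_one, ← hu, u.inv_mul]
  · exact heq
  · refine absurd ⟨‖z‖ - 1, by linarith, fun x => ?_⟩ hz
    have h1 := norm_sub_norm_le (z • x) (cauchyDual T x)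
    have h2 := norm_cauchyDual_apply_le hexp x
    rw [norm_sub_rev, norm_smul] at h1
    simp only [sub_apply, smul_apply,
      one_apply_eq_self]
    linarith

end CauchyDual

/-- If `T` is a non-invertible expansion with `σ_ap(T) ⊆ ∂𝔻`, then
`σ(T) = closure 𝔻 = σ(T')` and `σ_ap(T) = ∂𝔻 = σ_ap(T')`. -/
theorem stmt_14 {H : Type*} [NormedAddCommGroup H] [InnerProductSpace ℂ H] [CompleteSpace H]
    (T : H →L[ℂ] H) (hexp : ∀ x : H, ‖x‖ ≤ ‖T x‖) (hni : ¬ IsUnit T)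
    (hap : approxPointSpectrum T ⊆ Metric.sphere (0 : ℂ) 1) :
    spectrum ℂ T = Metric.closedBall (0 : ℂ) 1 ∧
    spectrum ℂ (cauchyDual T) = Metric.closedBall (0 : ℂ) 1 ∧
    approxPointSpectrum T = Metric.sphere (0 : ℂ) 1 ∧
    approxPointSpectrum (cauchyDual T) = Metric.sphere (0 : ℂ) 1 := by
  have hσ := spectrum_eq_closedBall_of_approxPointSpectrum_subset_sphere hni hap
  have hni' := not_isUnit_cauchyDual hexp hni
  have hap' := approxPointSpectrum_cauchyDual_subset_sphere hexp hσ.subset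
  exact ⟨hσ, spectrum_eq_closedBall_of_approxPointSpectrum_subset_sphere hni' hap',
    approxPointSpectrum_eq_sphere hni hap, approxPointSpectrum_eq_sphere hni' hap'⟩
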